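/- Let Ω be a finite nonempty set, Θ a nonempty countable set, and P₀ : Θ → (0,1] with ∑_{θ∈Θ} P₀(θ) = 1. For each θ ∈ Θ let λ^θ : 𝒫(Ω) × Ω → [0,∞] be a loss function, Λ^θ := {λ^θ(π,·) : π ∈ 𝒫(Ω)} its prediction set and Σ_{Λ^θ} the superprediction set of Λ^θ, and suppose there are reals c^θ ≥ 1 and η^θ > 0 such that for every g ∈ Σ_{Λ^θ} the function q_g^θ(π,ω) := exp(η^θ·λ^θ(π,ω)/c^θ)·exp(−η^θ·g(ω)) is forecast-continuous and has the supermartingale property. For expert decisions π_n^θ ∈ 𝒫(Ω), Learner decisions π_n ∈ 𝒫(Ω) and outcomes ω_n ∈ Ω define W_n := ∑_{θ∈Θ} P₀(θ)·∏_{k=1}^{n} exp(η^θ·λ^θ(π_k,ω_k)/c^θ)·exp(−η^θ·λ^θ(π_k^θ,ω_k)) (so W_0 = 1). Then: (i) for every n ≥ 1, given any π_k, π_k^θ, ω_k (k ≤ n−1) and π_n^θ (θ ∈ Θ), there exists π_n ∈ 𝒫(Ω) such that for all ω ∈ Ω, ∑_{θ∈Θ} P₀(θ)·(∏_{k=1}^{n−1}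 exp(η^θ·λ^θ(π_k,ω_k)/c^θ)·exp(−η^θ·λ^θ(π_k^θ,ω_k)))·exp(η^θ·λ^θ(π_n,ω)/c^θ)·exp(−η^θ·λ^θ(π_n^θ,ω)) ≤ W_{n−1}; (ii) if N ≥ 1 and π_1,…,π_N satisfy W_n ≤ W_{n−1} for n = 1,…,N, then for every θ ∈ Θ: ∑_{n=1}^N λ^θ(π_n,ω_n) ≤ c^θ·∑_{n=1}^N λ^θ(π_n^θ,ω_n) + (c^θ/η^θ)·ln(1/P₀(θ)) in [0,∞]. -/

import Mathlib

open scoped ENNReal BigOperators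
open Filter

noncomputable section

variable {Ω : Type*} [Fintype Ω]

/-- `pexp r t = exp(r·t)` for `t ∈ [0,∞]`, with value `∞` when `t = ∞`. -/
def pexp (r : ℝ) (t : ℝ≥0∞) : ℝ≥0∞ :=
  if t = ∞ then ∞ else ENNReal.ofReal (Real.exp (r * t.toReal))

/-- `nexp r t = exp(−r·t)` for `t ∈ [0,∞]`, with value `0` when `t = ∞`. -/
def nexp (r : ℝ) (t : ℝ≥0∞) : ℝ≥0∞ :=
  if t = ∞ then 0 else ENNReal.ofReal (Real.exp (-(r * t.toReal)))

/-- Expectation `E_π g = ∑_{ω : π ω ≠ 0} π(ω)·g(ω)` in `[0,∞]` (since `0·∞ = 0` in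
`ℝ≥0∞`, the terms with `π ω = 0` contribute nothing, so we may sum over all `ω`). -/
def expect (π : Ω → ℝ) (g : Ω → ℝ≥0∞) : ℝ≥0∞ :=
  ∑ ω, ENNReal.ofReal (π ω) * g ω

/-- The superprediction set `Σ_Λ` of a game `(Ω, Λ)`. -/
def superpred (Λ : Set (Ω → ℝ≥0∞)) : Set (Ω → ℝ≥0∞) :=
  {g | ∃ γ ∈ Λ, ∀ ω, γ ω ≤ g ω}

/-- `−(1/η)·ln x`, with value `∞` at `x = 0`. -/
def negLogDiv (η : ℝ) (x : ℝ≥0∞) : ℝ≥0∞ :=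
  if x = 0 then ∞ else ENNReal.ofReal (-(1 / η) * Real.log x.toReal)

/-- The exp-convex hull `Σ_Λ^η` of the superprediction set. -/
def expHull (η : ℝ) (Λ : Set (Ω → ℝ≥0∞)) : Set (Ω → ℝ≥0∞) :=
  {g | ∃ k : ℕ, 0 < k ∧ ∃ (gs : Fin k → Ω → ℝ≥0∞) (ρ : Fin k → ℝ),
    (∀ i, gs i ∈ superpred Λ) ∧ (∀ i, 0 ≤ ρ i) ∧ (∑ i, ρ i = 1) ∧
    ∀ ω, g ω = negLogDiv η (∑ i, ENNReal.ofReal (ρ i) * nexp η (gs i ω))}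

/-- The set of minimal elements of `X`. -/
def minSet (X : Set (Ω → ℝ≥0∞)) : Set (Ω → ℝ≥0∞) :=
  {g | g ∈ X ∧ ∀ g' ∈ X, (∀ ω, g' ω ≤ g ω) → g' = g}

/-- If `f` maps `D` onto a set with one element less, exactly two elements of `D` can be dropped
without losing surjectivity. -/
theorem exists_pair_image_erase {α β : Type*} [DecidableEq α] [DecidableEq β]
    {D : Finset α} {τ : Finset β} {f : α → β}
    (hf : D.image f = τ) (hcard : D.card = τ.card + 1) :
    ∃ a ∈ D, ∃ b ∈ D, a ≠ b ∧ ∀ j ∈ D, (D.erase j).image f = τ ↔ j = a ∨ j = b := by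
  have hlt : (D.image f).card < D.card := by rw [hf]; omega
  obtain ⟨a, ha, b, hb, hab, hfab⟩ :
      ∃ a ∈ D, ∃ b ∈ D, a ≠ b ∧ f a = f b := by
    by_contra! h
    exact hlt.ne (Finset.card_image_of_injOn fun x hx y hy hxy => by
      by_contra hne
      exact h x hx y hy hne hxy)
  have key : ∀ a ∈ D, ∀ b ∈ D, a ≠ b → f a = f b → (D.erase a).image f = τ := by
    intro a ha b hb hab hfab
    rw [← hf]
    ext z
    simp only [Finset.mem_image, Finset.mem_erase]
    constructor
    · rintro ⟨x, ⟨_, hx⟩, rfl⟩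
      exact ⟨x, hx, rfl⟩
    · rintro ⟨x, hx, rfl⟩
      by_cases hxa : x = a
      · exact ⟨b, ⟨hab.symm, hb⟩, by rw [hxa, hfab]⟩
      · exact ⟨x, ⟨hxa, hx⟩, rfl⟩
  refine ⟨a, ha, b, hb, hab, fun j hj => ⟨fun h => ?_, ?_⟩⟩
  · by_contra! hne
    have hinj : Set.InjOn f (D.erase j : Finset α) := by
      rw [← Finset.card_image_iff, h, Finset.card_erase_of_mem hj]
      omega
    exact hab (hinj (by simp [ha, hne.1.symm]) (by simp [hb, hne.2.symm]) hfab)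
  · rintro (rfl | rfl)
    · exact key _ hj b hb hab hfab
    · exact key _ hj a ha hab.symm hfab.symm

namespace Scarf

variable {T I L : Type*} [LinearOrder L]

/-- With respect to the orders `r i`, `i ∈ C`, no point lies above all of `σ`. -/
def Dominant (r : I → T → L) (σ : Finset T) (C : Finset I) : Prop :=
  ∀ y, ∃ i ∈ C, ∀ x ∈ σ, r i y ≤ r i x

theorem Dominant.mono {r : I → T → L} {σ τ : Finset T} {C D : Finset I}
    (h : Dominant r σ C) (hτ : τ ⊆ σ) (hC : C ⊆ D) : Dominant r τ D := fun y =>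
  let ⟨i, hi, hy⟩ := h y
  ⟨i, hC hi, fun x hx => hy x (hτ hx)⟩

/-- A room is a dominant pair with as many points as orders. -/
def Room (r : I → T → L) (p : Finset T × Finset I) : Prop :=
  Dominant r p.1 p.2 ∧ p.1.card = p.2.card

/-- The rooms adjacent to a door `(τ, D)` at which the order `a` is released. -/
def Beyond [DecidableEq T] [DecidableEq I] (r : I → T → L) (m : I → T) (τ : Finset T)
    (D : Finset I) (a : I) (p : Finset T × Finset I) : Prop :=
  p = (τ, D.erase a) ∨
    ∃ y, y ∉ τ ∧ p = (insert y τ, D) ∧ ∀ j ∈ D.erase a, r j (m j) < r j y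

open scoped Classical in
theorem existsUnique_beyond [Finite T] {r : I → T → L} (hr : ∀ i, Function.Injective (r i))
    {τ : Finset T} {D : Finset I} (hdom : Dominant r τ D) (hcard : D.card = τ.card + 1)
    {m : I → T} (hm : ∀ i, m i ∈ τ) (hmin : ∀ i, ∀ x ∈ τ, r i (m i) ≤ r i x)
    {a : I} (ha : a ∈ D) (himg : (D.erase a).image m = τ) :
    ∃! p, Room r p ∧ Beyond r m τ D a p := by
  have hnot : ∀ y, (∀ j ∈ D.erase a, r j (m j) < r j y) → y ∉ τ := by
    intro y hy hyτ
    rw [← himg, Finset.mem_image] at hyτ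
    obtain ⟨j, hj, rfl⟩ := hyτ
    exact lt_irrefl _ (hy j hj)
  by_cases hM : ∃ y, ∀ j ∈ D.erase a, r j (m j) < r j y
  · obtain ⟨y, hy, hmax⟩ := Set.exists_max_image {y | ∀ j ∈ D.erase a, r j (m j) < r j y} (r a)
      (Set.toFinite _) hM
    refine ⟨(insert y τ, D), ⟨⟨?_, ?_⟩, Or.inr ⟨y, hnot y hy, rfl, hy⟩⟩, ?_⟩
    · intro z
      by_contra! hz
      have hzM : ∀ j ∈ D.erase a, r j (m j) < r j z := by
        intro j hj
        obtain ⟨x, hx, hlt⟩ := hz j (Finset.mem_of_mem_erase hj)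
        rcases Finset.mem_insert.1 hx with rfl | hx
        · exact (hy j hj).trans hlt
        · exact (hmin j x hx).trans_lt hlt
      have hzy := hmax z hzM
      obtain ⟨x, hx, hlt⟩ := hz a ha
      rcases Finset.mem_insert.1 hx with rfl | hx
      · exact absurd hzy hlt.not_ge
      · obtain ⟨i, hi, hle⟩ := hdom y
        have hile := hle (m i) (hm i)
        by_cases hia : i = a
        · subst hia
          exact absurd (hile.trans (hmin i x hx)) (hlt.trans_le hzy).not_ge
        · exact absurd hile (hy i (Finset.mem_erase.2 ⟨hia, hi⟩)).not_ge
    · simp only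
      rw [Finset.card_insert_of_notMem (hnot y hy), hcard]
    · rintro p ⟨⟨hpd, -⟩, rfl | ⟨y', hy', rfl, hy'M⟩⟩
      · obtain ⟨i, hi, hle⟩ := hpd y
        exact absurd (hle (m i) (hm i)) (hy i hi).not_ge
      · obtain ⟨i, hi, hle⟩ := hpd y
        by_cases hia : i = a
        · subst hia
          have := hr i (le_antisymm (hle y' (Finset.mem_insert_self _ _)) (hmax y' hy'M))
          rw [this]
        · exact absurd (hle (m i) (Finset.mem_insert_of_mem (hm i)))
            (hy i (Finset.mem_erase.2 ⟨hia, hi⟩)).not_ge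
  · refine ⟨(τ, D.erase a), ⟨⟨?_, ?_⟩, Or.inl rfl⟩, ?_⟩
    · intro y
      push Not at hM
      obtain ⟨j, hj, hle⟩ := hM y
      exact ⟨j, hj, fun x hx => hle.trans (hmin j x hx)⟩
    · simp only
      rw [Finset.card_erase_of_mem ha, hcard, Nat.add_sub_cancel]
    · rintro p ⟨-, rfl | ⟨y', -, -, hy'M⟩⟩
      · rfl
      · exact absurd ⟨y', hy'M⟩ hM

open scoped Classical in
theorem not_beyond_beyond {r : I → T → L} {τ : Finset T} {D : Finset I} (hdom : Dominant r τ D)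
    {m : I → T} (hm : ∀ i, m i ∈ τ) {a b : I} (ha : a ∈ D) (hab : a ≠ b)
    {p : Finset T × Finset I} (hpa : Beyond r m τ D a p) : ¬ Beyond r m τ D b p := by
  rintro (h | ⟨y, hy, h, hyM⟩) <;> rcases hpa with rfl | ⟨y', hy', rfl, hyM'⟩
  · have hD : D.erase a = D.erase b := (Prod.ext_iff.1 h).2
    have hb : a ∈ D.erase b := Finset.mem_erase.2 ⟨hab, ha⟩
    rw [← hD] at hb
    simp at hb
  · have hτ : insert y' τ = τ := (Prod.ext_iff.1 h).1
    exact hy' (hτ ▸ Finset.mem_insert_self _ _)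
  · have hτ : τ = insert y τ := (Prod.ext_iff.1 h).1
    exact hy (hτ.symm ▸ Finset.mem_insert_self _ _)
  · have hτ : insert y' τ = insert y τ := (Prod.ext_iff.1 h).1
    have : y' ∈ insert y τ := hτ ▸ Finset.mem_insert_self _ _
    obtain rfl : y' = y := (Finset.mem_insert.1 this).resolve_right hy'
    obtain ⟨i, hi, hle⟩ := hdom y'
    by_cases hia : i = a
    · subst hia
      exact (hle _ (hm i)).not_gt (hyM i (Finset.mem_erase.2 ⟨hab, hi⟩))
    · exact (hle _ (hm i)).not_gt (hyM' i (Finset.mem_erase.2 ⟨hia, hi⟩))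

/-- A pair `(σ, C)` with `τ ⊆ σ`, `C ⊆ D` which is balanced, while `D` exceeds `τ` by one element,
differs from `(τ, D)` in a single element. -/
theorem adjacent_cases [DecidableEq T] [DecidableEq I] {σ τ : Finset T} {C D : Finset I}
    (hσ : τ ⊆ σ) (hC : C ⊆ D) (h₁ : σ.card = C.card) (h₂ : D.card = τ.card + 1) :
    (σ = τ ∧ ∃ j ∈ D, C = D.erase j) ∨ (C = D ∧ ∃ y, y ∉ τ ∧ σ = insert y τ) := by
  have h3 := Finset.card_le_card hσ
  have h4 := Finset.card_le_card hC
  rcases h3.eq_or_lt with h | h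
  · left
    refine ⟨(Finset.eq_of_subset_of_card_le hσ h.ge).symm, ?_⟩
    obtain ⟨j, hj, hins⟩ := (Finset.covBy_iff_exists_insert.1
      (Finset.covBy_iff_card_sdiff_eq_one.2 ⟨hC, by
        rw [Finset.card_sdiff_of_subset hC]; omega⟩) : ∃ j, j ∉ C ∧ insert j C = D)
    exact ⟨j, hins ▸ Finset.mem_insert_self _ _, by rw [← hins, Finset.erase_insert hj]⟩
  · right
    refine ⟨Finset.eq_of_subset_of_card_le hC (by omega), ?_⟩
    obtain ⟨y, hy, hins⟩ := (Finset.covBy_iff_exists_insert.1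
      (Finset.covBy_iff_card_sdiff_eq_one.2 ⟨hσ, by
        rw [Finset.card_sdiff_of_subset hσ]; omega⟩) : ∃ j, j ∉ τ ∧ insert j τ = σ)
    exact ⟨y, hy, hins.symm⟩

theorem Dominant.image_eq [DecidableEq T] {r : I → T → L} (hr : ∀ i, Function.Injective (r i))
    {τ : Finset T} {D : Finset I} (hdom : Dominant r τ D) {m : I → T} (hm : ∀ i, m i ∈ τ)
    (hmin : ∀ i, ∀ x ∈ τ, r i (m i) ≤ r i x) : D.image m = τ := by
  ext y
  rw [Finset.mem_image]
  constructor
  · rintro ⟨i, -, rfl⟩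
    exact hm i
  · intro hy
    obtain ⟨i, hi, hle⟩ := hdom y
    exact ⟨i, hi, hr i (le_antisymm (hmin i y hy) (hle _ (hm i)))⟩

open scoped Classical in
/-- A door with at least one point belongs to exactly two rooms. -/
theorem card_rooms_of_nonempty [Fintype T] [Fintype I] {r : I → T → L}
    (hr : ∀ i, Function.Injective (r i)) {τ : Finset T} {D : Finset I} (hdom : Dominant r τ D)
    (hcard : D.card = τ.card + 1) (hτ : τ.Nonempty) :
    (Finset.univ.filter fun p : Finset T × Finset I =>
      Room r p ∧ τ ⊆ p.1 ∧ p.2 ⊆ D).card = 2 := by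
  choose m hm hmin using fun i => Finset.exists_min_image τ (r i) hτ
  obtain ⟨a, ha, b, hb, hab, hiff⟩ :=
    exists_pair_image_erase (hdom.image_eq hr hm hmin) hcard
  obtain ⟨p, ⟨hpR, hpB⟩, hpu⟩ :=
    existsUnique_beyond hr hdom hcard hm hmin ha ((hiff a ha).2 (Or.inl rfl))
  obtain ⟨q, ⟨hqR, hqB⟩, hqu⟩ :=
    existsUnique_beyond hr hdom hcard hm hmin hb ((hiff b hb).2 (Or.inr rfl))
  have hadj : ∀ {c p}, Beyond r m τ D c p → τ ⊆ p.1 ∧ p.2 ⊆ D := by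
    rintro c p (rfl | ⟨y, -, rfl, -⟩)
    · exact ⟨subset_rfl, Finset.erase_subset _ _⟩
    · exact ⟨Finset.subset_insert _ _, subset_rfl⟩
  have hcases : ∀ s, Room r s → τ ⊆ s.1 → s.2 ⊆ D →
      ∃ j ∈ D, (D.erase j).image m = τ ∧ Beyond r m τ D j s := by
    rintro ⟨σ, C⟩ ⟨hd, hc⟩ hσ hC
    rcases adjacent_cases hσ hC hc hcard with ⟨h, j, hj, h'⟩ | ⟨h, y, hy, h'⟩ <;>
      subst h <;> subst h'
    · exact ⟨j, hj, Dominant.image_eq hr hd hm hmin, Or.inl rfl⟩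
    · obtain ⟨i, hi, hle⟩ := hd y
      have hcov : ∀ x ∈ τ, ∃ j ∈ C.erase i, m j = x ∧ r j x < r j y := by
        intro x hx
        obtain ⟨j, hj, hjx⟩ := hd x
        have hxy : x ≠ y := fun h => hy (h ▸ hx)
        have hlt : r j x < r j y := lt_of_le_of_ne (hjx y (Finset.mem_insert_self _ _))
          fun h => hxy (hr j h)
        refine ⟨j, Finset.mem_erase.2 ⟨?_, hj⟩, ?_, hlt⟩
        · rintro rfl
          exact (hle x (Finset.mem_insert_of_mem hx)).not_gt hlt
        · exact hr j (le_antisymm (hmin j x hx) (hjx _ (Finset.mem_insert_of_mem (hm j))))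
      have himg : (C.erase i).image m = τ := by
        ext x
        rw [Finset.mem_image]
        exact ⟨fun ⟨j, _, h⟩ => h ▸ hm j, fun hx =>
          let ⟨j, hj, h, _⟩ := hcov x hx
          ⟨j, hj, h⟩⟩
      have hinj : Set.InjOn m (C.erase i : Finset I) := by
        rw [← Finset.card_image_iff, himg, Finset.card_erase_of_mem hi]
        omega
      refine ⟨i, hi, himg, Or.inr ⟨y, hy, rfl, fun j hj => ?_⟩⟩
      obtain ⟨k, hk, hkm, hlt⟩ := hcov (m j) (hm j)
      exact hinj hk hj hkm ▸ hinj hk hj hkm ▸ hlt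
  rw [Finset.card_eq_two]
  refine ⟨p, q, ?_, ?_⟩
  · rintro rfl
    exact not_beyond_beyond hdom hm ha hab hpB hqB
  · ext s
    simp only [Finset.mem_filter, Finset.mem_univ, true_and, Finset.mem_insert,
      Finset.mem_singleton]
    constructor
    · rintro ⟨hs, hs1, hs2⟩
      obtain ⟨j, hj, himg, hB⟩ := hcases s hs hs1 hs2
      rcases (hiff j hj).1 himg with rfl | rfl
      · exact Or.inl (hpu s ⟨hs, hB⟩)
      · exact Or.inr (hqu s ⟨hs, hB⟩)
    · rintro (rfl | rfl)
      · exact ⟨hpR, hadj hpB⟩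
      · exact ⟨hqR, hadj hqB⟩

open scoped Classical in
/-- A door without points belongs to exactly one room. -/
theorem card_rooms_empty [Fintype T] [Fintype I] [Nonempty T] {r : I → T → L}
    (hr : ∀ i, Function.Injective (r i)) (i : I) :
    (Finset.univ.filter fun p : Finset T × Finset I =>
      Room r p ∧ ∅ ⊆ p.1 ∧ p.2 ⊆ {i}).card = 1 := by
  obtain ⟨x, hx⟩ := Finite.exists_max (r i)
  rw [Finset.card_eq_one]
  refine ⟨({x}, {i}), ?_⟩
  ext ⟨σ, C⟩
  simp only [Finset.mem_filter, Finset.mem_univ, true_and, Finset.mem_singleton, Prod.mk.injEq]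
  constructor
  · rintro ⟨⟨hd, hc⟩, -, hC⟩
    obtain ⟨j, hj, hle⟩ := hd x
    obtain rfl : j = i := by simpa using hC hj
    obtain rfl : C = {j} := Finset.Subset.antisymm hC (by simpa using hj)
    obtain ⟨z, rfl⟩ := Finset.card_eq_one.1 (hc.trans (Finset.card_singleton j))
    exact ⟨by rw [hr j (le_antisymm (hle z (by simp)) (hx z))], rfl⟩
  · rintro ⟨rfl, rfl⟩
    exact ⟨⟨fun y => ⟨i, by simp, by simpa using hx y⟩, by simp⟩, by simp, subset_rfl⟩

/-- A door is typed if its orders are the colours of its points and the additional colour `i₀`. -/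
def TypedDoor [DecidableEq I] (r : I → T → L) (c : T → I) (i₀ : I)
    (d : Finset T × Finset I) : Prop :=
  Dominant r d.1 d.2 ∧ d.2.card = d.1.card + 1 ∧ d.2 = insert i₀ (d.1.image c)

open scoped Classical in
/-- A room whose points do not have exactly the colours of the room has an even number of typed
doors. -/
theorem even_card_doors [Fintype T] [Fintype I] {r : I → T → L} (c : T → I) (i₀ : I)
    {p : Finset T × Finset I} (hp : Room r p) (hne : p.1.image c ≠ p.2) :
    Even (Finset.univ.filter fun d : Finset T × Finset I =>
      TypedDoor r c i₀ d ∧ d.1 ⊆ p.1 ∧ p.2 ⊆ d.2).card := by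
  obtain ⟨σ, C⟩ := p
  obtain ⟨hd, hc⟩ := hp
  simp only at hd hc hne ⊢
  set F := Finset.univ.filter fun d : Finset T × Finset I =>
      TypedDoor r c i₀ d ∧ d.1 ⊆ σ ∧ C ⊆ d.2 with hF
  rcases F.eq_empty_or_nonempty with h0 | ⟨d, hdF⟩
  · simp [h0]
  set E := insert i₀ (σ.image c) with hE
  have hdE : ∀ {τ D}, TypedDoor r c i₀ (τ, D) → τ ⊆ σ → D ⊆ E := by
    rintro τ D ⟨-, -, h⟩ hτ
    simp only at h
    rw [h]
    exact Finset.insert_subset_insert _ (Finset.image_subset_image hτ)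
  have hCE : C ⊆ E := by
    obtain ⟨τ, D⟩ := d
    simp only [hF, Finset.mem_filter, Finset.mem_univ, true_and] at hdF
    exact hdF.2.2.trans (hdE hdF.1 hdF.2.1)
  have hEcard : E.card ≤ C.card + 1 := by
    rw [← hc]
    exact (Finset.card_insert_le _ _).trans (Nat.succ_le_succ Finset.card_image_le)
  have hmemF : ∀ τ D, (τ, D) ∈ F ↔
      (τ = σ ∧ C ⊆ D ∧ D.card = C.card + 1 ∧ D = E) ∨
      (D = C ∧ ∃ x ∈ σ, τ = σ.erase x ∧ C = insert i₀ ((σ.erase x).image c)) := by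
    intro τ D
    simp only [hF, Finset.mem_filter, Finset.mem_univ, true_and]
    constructor
    · rintro ⟨⟨-, h2, h3⟩, h4, h5⟩
      simp only at h2 h3
      rcases adjacent_cases h4 h5 hc h2 with ⟨h, -⟩ | ⟨h, x, hx, h'⟩
      · subst h
        exact Or.inl ⟨rfl, h5, by omega, h3⟩
      · right
        refine ⟨h.symm, x, h' ▸ Finset.mem_insert_self _ _, ?_⟩
        have : σ.erase x = τ := by rw [h', Finset.erase_insert hx]
        exact ⟨this.symm, by rw [this, h, h3]⟩
    · rintro (⟨rfl, h1, h2, rfl⟩ | ⟨rfl, x, hx, rfl, h⟩)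
      · exact ⟨⟨hd.mono subset_rfl h1, by simp only; omega, rfl⟩, subset_rfl, h1⟩
      · refine ⟨⟨hd.mono (Finset.erase_subset _ _) subset_rfl, ?_, h⟩, Finset.erase_subset _ _,
          subset_rfl⟩
        simp only
        rw [Finset.card_erase_of_mem hx, ← hc]
        have := Finset.card_pos.2 ⟨x, hx⟩
        omega
  -- Adjoin a ghost point of colour `i₀`.
  let c' : Option T → I := fun o => o.elim i₀ c
  have himg : ∀ s : Finset T, (Finset.insertNone s).image c' = insert i₀ (s.image c) := by
    intro s
    ext i
    simp [c', Finset.mem_image, Option.exists, eq_comm]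
  have herase : ∀ x, (Finset.insertNone σ).erase (some x) = Finset.insertNone (σ.erase x) := by
    intro x
    ext o
    cases o <;> simp
  have hcardN : (Finset.insertNone σ).card = C.card + 1 := by
    rw [Finset.card_insertNone, hc]
  have hghost : ((Finset.insertNone σ).erase none).image c' ≠ C := by
    intro h
    apply hne
    rw [← h]
    ext i
    simp [c', Finset.mem_image, Option.exists]
  suffices h2 : F.card = 2 by rw [h2]; exact even_two
  rw [Finset.card_eq_two]
  by_cases hCE' : C = E
  · obtain ⟨a, ha, b, hb, hab, hiff⟩ := exists_pair_image_erase
      ((himg σ).trans hCE'.symm) hcardN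
    have hsome : ∀ o ∈ Finset.insertNone σ, ((Finset.insertNone σ).erase o).image c' = C →
        ∃ x ∈ σ, o = some x := by
      rintro (_ | x) ho h
      · exact absurd h hghost
      · exact ⟨x, by simpa using ho, rfl⟩
    obtain ⟨x, hx, rfl⟩ := hsome a ha ((hiff a ha).2 (Or.inl rfl))
    obtain ⟨y, hy, rfl⟩ := hsome b hb ((hiff b hb).2 (Or.inr rfl))
    have hiff' : ∀ z ∈ σ, C = insert i₀ ((σ.erase z).image c) ↔ z = x ∨ z = y := by
      intro z hz
      rw [eq_comm, ← himg, ← herase, hiff (some z) (by simpa using hz)]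
      simp
    refine ⟨(σ.erase x, C), (σ.erase y, C), ?_, ?_⟩
    · intro h
      have hxy : x ≠ y := fun h => hab (by rw [h])
      have hσ : σ.erase x = σ.erase y := (Prod.ext_iff.1 h).1
      have hmem : x ∈ σ.erase y := Finset.mem_erase.2 ⟨hxy, hx⟩
      rw [← hσ] at hmem
      simp at hmem
    · ext ⟨τ, D⟩
      rw [hmemF]
      simp only [Finset.mem_insert, Finset.mem_singleton, Prod.mk.injEq]
      constructor
      · rintro (⟨-, -, h, h'⟩ | ⟨rfl, z, hz, rfl, h⟩)
        · rw [h', ← hCE'] at h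
          omega
        · rcases (hiff' z hz).1 h with rfl | rfl <;> simp
      · rintro (⟨rfl, rfl⟩ | ⟨rfl, rfl⟩)
        · exact Or.inr ⟨rfl, x, hx, rfl, (hiff' x hx).2 (Or.inl rfl)⟩
        · exact Or.inr ⟨rfl, y, hy, rfl, (hiff' y hy).2 (Or.inr rfl)⟩
  · have hEc : E.card = C.card + 1 := by
      have := Finset.card_lt_card (hCE.ssubset_of_ne hCE')
      omega
    have hinj : Set.InjOn c' (Finset.insertNone σ : Finset (Option T)) := by
      rw [← Finset.card_image_iff, himg, hcardN, ← hEc]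
    obtain ⟨i, hiE, hiC⟩ := Finset.exists_of_ssubset (hCE.ssubset_of_ne hCE')
    have hCi : C = E.erase i := by
      refine Finset.eq_of_subset_of_card_le (fun j hj => Finset.mem_erase.2
        ⟨fun h => hiC (h ▸ hj), hCE hj⟩) ?_
      rw [Finset.card_erase_of_mem hiE]
      omega
    have herase' : ∀ o ∈ Finset.insertNone σ,
        ((Finset.insertNone σ).erase o).image c' = E.erase (c' o) := by
      intro o ho
      rw [hE, ← himg]
      ext j
      simp only [Finset.mem_image, Finset.mem_erase]
      constructor
      · rintro ⟨o', ⟨h1, h2⟩, rfl⟩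
        exact ⟨fun h => h1 (hinj h2 ho h), o', h2, rfl⟩
      · rintro ⟨h1, o', h2, rfl⟩
        exact ⟨o', ⟨fun h => h1 (by rw [h]), h2⟩, rfl⟩
    obtain ⟨o, ho, hoi⟩ := Finset.mem_image.1
      ((himg σ).symm ▸ hiE : i ∈ (Finset.insertNone σ).image c')
    obtain ⟨x, hx, rfl⟩ : ∃ x ∈ σ, o = some x := by
      rcases o with _ | x
      · exact absurd ((herase' none ho).trans (hoi.symm ▸ hCi.symm)) hghost
      · exact ⟨x, by simpa using ho, rfl⟩
    have hiff' : ∀ z ∈ σ, C = insert i₀ ((σ.erase z).image c) ↔ z = x := by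
      intro z hz
      have hz' : some z ∈ Finset.insertNone σ := by simpa using hz
      rw [← himg, ← herase, herase' _ hz', hCi]
      constructor
      · intro h
        have hmem : c' (some z) ∈ E := by
          rw [hE, ← himg]
          exact Finset.mem_image_of_mem _ hz'
        have : c' (some z) = c' (some x) := by
          by_contra hcz
          have : c' (some z) ∈ E.erase i := Finset.mem_erase.2 ⟨hoi ▸ hcz, hmem⟩
          rw [h] at this
          simp at this
        simpa using hinj hz' ho this
      · rintro rfl
        rw [hoi]
    refine ⟨(σ, E), (σ.erase x, C), ?_, ?_⟩
    · intro h
      have := (Prod.ext_iff.1 h).2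
      exact hCE' this.symm
    · ext ⟨τ, D⟩
      rw [hmemF]
      simp only [Finset.mem_insert, Finset.mem_singleton, Prod.mk.injEq]
      constructor
      · rintro (⟨h1, -, -, h4⟩ | ⟨h1, z, hz, h2, h⟩)
        · exact Or.inl ⟨h1, h4⟩
        · obtain rfl := (hiff' z hz).1 h
          exact Or.inr ⟨h2, h1⟩
      · rintro (⟨rfl, rfl⟩ | ⟨rfl, rfl⟩)
        · exact Or.inl ⟨rfl, hCE, hEc, rfl⟩
        · exact Or.inr ⟨rfl, x, hx, rfl, (hiff' x hx).2 rfl⟩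

open scoped Classical in
/-- **Scarf's lemma**: every colouring of a finite set by its linear orders admits a dominant pair
`(σ, C)` such that `C` is the set of colours of `σ`. -/
theorem exists_colorful [Fintype T] [Fintype I] [Nonempty T] [Nonempty I] {r : I → T → L}
    (hr : ∀ i, Function.Injective (r i)) (c : T → I) :
    ∃ (σ : Finset T) (C : Finset I), Dominant r σ C ∧ σ.image c = C := by
  by_contra! hno
  obtain ⟨i₀⟩ := ‹Nonempty I›
  let R := Finset.univ.filter fun p : Finset T × Finset I => Room r p
  let E := Finset.univ.filter fun d : Finset T × Finset I => TypedDoor r c i₀ d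
  have hcount := Finset.sum_card_bipartiteAbove_eq_sum_card_bipartiteBelow
    (s := R) (t := E) (fun p d : Finset T × Finset I => d.1 ⊆ p.1 ∧ p.2 ⊆ d.2)
  have heven : Even (∑ p ∈ R, (E.bipartiteAbove
      (fun p d : Finset T × Finset I => d.1 ⊆ p.1 ∧ p.2 ⊆ d.2) p).card) := by
    refine Finset.even_sum _ fun p hp => ?_
    have hp' : Room r p := (Finset.mem_filter.1 hp).2
    have := even_card_doors c i₀ hp' (hno _ _ hp'.1)
    simpa only [Finset.bipartiteAbove, E, Finset.filter_filter] using this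
  have hmem : ((∅, {i₀}) : Finset T × Finset I) ∈ E := by
    refine Finset.mem_filter.2 ⟨Finset.mem_univ _, fun y => ⟨i₀, by simp, by simp⟩, ?_, ?_⟩ <;> simp
  rw [hcount, ← Finset.add_sum_erase _ _ hmem] at heven
  have h1 : (R.bipartiteBelow (fun p d : Finset T × Finset I => d.1 ⊆ p.1 ∧ p.2 ⊆ d.2)
      (∅, {i₀})).card = 1 := by
    simpa only [Finset.bipartiteBelow, R, Finset.filter_filter] using card_rooms_empty hr i₀
  have h2 : Even (∑ d ∈ E.erase (∅, {i₀}), (R.bipartiteBelow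
      (fun p d : Finset T × Finset I => d.1 ⊆ p.1 ∧ p.2 ⊆ d.2) d).card) := by
    refine Finset.even_sum _ fun d hd => ?_
    obtain ⟨hne, hdE⟩ := Finset.mem_erase.1 hd
    obtain ⟨τ, D⟩ := d
    obtain ⟨hdom, hcard, hD⟩ := (Finset.mem_filter.1 hdE).2
    have hτ : τ.Nonempty := by
      rw [Finset.nonempty_iff_ne_empty]
      rintro rfl
      exact hne (by simpa using hD)
    have := card_rooms_of_nonempty hr hdom hcard hτ
    simp only [Finset.bipartiteBelow, R, Finset.filter_filter]
    rw [this]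
    exact even_two
  rw [h1, Nat.even_add] at heven
  exact Nat.not_even_one (heven.2 h2)

end Scarf

open scoped Classical in
/-- An open version of the **Knaster–Kuratowski–Mazurkiewicz lemma**: if open sets `U i` cover the
standard simplex, some point of the simplex lies in `U i` for every `i` in its support. -/
theorem exists_mem_stdSimplex_forall_pos_mem {I : Type*} [Fintype I] [Nonempty I]
    {U : I → Set (I → ℝ)} (hU : ∀ i, IsOpen (U i)) (hcov : stdSimplex ℝ I ⊆ ⋃ i, U i) :
    ∃ π ∈ stdSimplex ℝ I, ∀ i, 0 < π i → π ∈ U i := by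
  obtain ⟨δ, hδ, hball⟩ := lebesgue_number_lemma_of_metric (isCompact_stdSimplex ℝ I) hU hcov
  obtain ⟨N, hN⟩ := exists_nat_gt (Fintype.card I / δ)
  have hN0 : (0 : ℝ) < N := lt_of_le_of_lt (by positivity) hN
  rw [div_lt_iff₀ hδ] at hN
  let T := {a : I → ℕ // ∑ i, a i = N}
  let emb : T → {a // a ∈ Finset.piAntidiag (Finset.univ : Finset I) N} := fun a =>
    ⟨a.1, Finset.mem_piAntidiag.2 ⟨a.2, by simp⟩⟩
  have : Finite T := Finite.of_injective emb fun a b h => Subtype.ext (congrArg (fun x => x.1) h)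
  have : Fintype T := Fintype.ofFinite T
  have : Nonempty T := ⟨⟨Pi.single (Classical.arbitrary I) N, by simp⟩⟩
  let pt : T → I → ℝ := fun a i => a.1 i / N
  have hpt : ∀ a, pt a ∈ stdSimplex ℝ I := fun a => by
    refine ⟨fun i => by positivity, ?_⟩
    simp only [pt]
    rw [← Finset.sum_div, ← Nat.cast_sum, a.2, div_self hN0.ne']
  choose c hc using fun a => hball (pt a) (hpt a)
  let r : I → T → ℕ ×ₗ Fin (Fintype.card T) := fun i a => toLex (a.1 i, Fintype.equivFin T a)
  have hr : ∀ i, Function.Injective (r i) := fun i a b h =>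
    (Fintype.equivFin T).injective (congrArg (fun x => (ofLex x).2) h)
  have hr_le : ∀ {i a b}, r i a ≤ r i b → a.1 i ≤ b.1 i := by
    intro i a b h
    exact Prod.Lex.monotone_fst _ _ h
  obtain ⟨σ, C, hdom, hcol⟩ := Scarf.exists_colorful hr c
  obtain ⟨i₀, hi₀, -⟩ := hdom (Classical.arbitrary T)
  have hσ : σ.Nonempty := by
    rw [← Finset.image_nonempty (f := c), hcol]
    exact ⟨i₀, hi₀⟩
  choose b hbσ hb using fun i => Finset.exists_min_image σ (fun a => a.1 i) hσ
  let q : I → ℕ := fun i => if i ∈ C then (b i).1 i else 0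
  have hq_le : ∀ x ∈ σ, ∀ i, q i ≤ x.1 i := by
    intro x hx i
    simp only [q]
    split_ifs
    · exact hb i x hx
    · exact Nat.zero_le _
  have hq_sum : ∑ i, q i ≤ N := by
    obtain ⟨x, hx⟩ := hσ
    rw [← x.2]
    exact Finset.sum_le_sum fun i _ => hq_le x hx i
  have hq_lt : N < ∑ i, q i + Fintype.card I := by
    by_contra! hle
    have hle' : ∑ i, (q i + 1) ≤ N := by
      rw [Finset.sum_add_distrib]
      simpa using hle
    obtain ⟨i, hi, hmin⟩ := hdom
      ⟨fun i => (q i + 1) + if i = i₀ then N - ∑ i, (q i + 1) else 0, by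
        rw [Finset.sum_add_distrib]
        simp only [Finset.sum_ite_eq', Finset.mem_univ, if_true]
        omega⟩
    have h := hr_le (hmin (b i) (hbσ i))
    simp only [q, hi, if_true] at h
    omega
  obtain ⟨k, hk⟩ := Nat.exists_eq_add_of_le hq_sum
  have hkδ : (k : ℝ) / N < δ := by
    rw [div_lt_iff₀ hN0, mul_comm]
    refine lt_trans ?_ hN
    exact_mod_cast (by omega : k < Fintype.card I)
  let p : T := ⟨fun i => q i + if i = i₀ then k else 0, by
    rw [Finset.sum_add_distrib]
    simp only [Finset.sum_ite_eq', Finset.mem_univ, if_true]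
    exact hk.symm⟩
  refine ⟨pt p, hpt p, fun i hi => ?_⟩
  have hiC : i ∈ C := by
    by_contra hiC
    have hii₀ : i ≠ i₀ := fun h => hiC (h ▸ hi₀)
    simp [pt, p, q, hiC, hii₀] at hi
  rw [← hcol, Finset.mem_image] at hiC
  obtain ⟨x, hx, rfl⟩ := hiC
  apply hc x
  rw [Metric.mem_ball, dist_pi_lt_iff hδ]
  intro j
  have hxj : x.1 j ≤ q j + k := by
    have h1 : ∑ i, (x.1 i - q i) = k := by
      have h2 : ∑ i, (x.1 i - q i) + ∑ i, q i = N := by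
        rw [← Finset.sum_add_distrib]
        refine Eq.trans ?_ x.2
        exact Finset.sum_congr rfl fun i _ => Nat.sub_add_cancel (hq_le x hx i)
      omega
    have h3 := Finset.single_le_sum (f := fun i => x.1 i - q i) (fun i _ => Nat.zero_le _)
      (Finset.mem_univ j)
    omega
  have hjx := hq_le x hx j
  have hjp : q j ≤ p.1 j := Nat.le_add_right _ _
  have hpj : p.1 j ≤ q j + k := by
    simp only [p]
    split_ifs <;> omega
  refine lt_of_le_of_lt ?_ hkδ
  rw [Real.dist_eq, ← sub_div, abs_div, abs_of_pos hN0]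
  refine div_le_div_of_nonneg_right ?_ hN0.le
  rw [abs_le]
  have e1 : (x.1 j : ℝ) ≤ q j + k := by exact_mod_cast hxj
  have e2 : (q j : ℝ) ≤ x.1 j := by exact_mod_cast hjx
  have e3 : (q j : ℝ) ≤ p.1 j := by exact_mod_cast hjp
  have e4 : (p.1 j : ℝ) ≤ q j + k := by exact_mod_cast hpj
  constructor <;> linarith

/-- **Levin's lemma** for lower semicontinuous functions: if `E_π f(π, ·) ≤ K` for all `π`, then
`f(π, ·) ≤ K` for some `π`. -/
theorem exists_forall_le_of_expect_le {Ω : Type*} [Fintype Ω] [Nonempty Ω]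
    {f : (Ω → ℝ) → Ω → ℝ≥0∞} {K : ℝ≥0∞}
    (hf : ∀ ω, LowerSemicontinuousOn (fun π => f π ω) (stdSimplex ℝ Ω))
    (hK : ∀ π ∈ stdSimplex ℝ Ω, expect π (f π) ≤ K) :
    ∃ π ∈ stdSimplex ℝ Ω, ∀ ω, f π ω ≤ K := by
  by_contra! hno
  choose U hUo hU using fun ω => lowerSemicontinuousOn_iff_preimage_Ioi.1 (hf ω) K
  have hmem : ∀ π ∈ stdSimplex ℝ Ω, ∀ ω, π ∈ U ω ↔ K < f π ω := by
    intro π hπ ω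
    have h := Set.ext_iff.1 (hU ω) π
    simp only [Set.mem_inter_iff, hπ, true_and, Set.mem_preimage, Set.mem_Ioi] at h
    exact h.symm
  obtain ⟨π, hπ, hpos⟩ := exists_mem_stdSimplex_forall_pos_mem hUo fun π hπ =>
    let ⟨ω, hω⟩ := hno π hπ
    Set.mem_iUnion.2 ⟨ω, (hmem π hπ ω).2 hω⟩
  have hlt : ∀ ω, 0 < π ω → K < f π ω := fun ω h => (hmem π hπ ω).1 (hpos ω h)
  have hsum : ∑ ω, ENNReal.ofReal (π ω) = 1 := by
    rw [← ENNReal.ofReal_sum_of_nonneg fun ω _ => hπ.1 ω, hπ.2, ENNReal.ofReal_one]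
  set s := Finset.univ.filter fun ω => 0 < π ω with hs
  have hrestrict : ∀ g : Ω → ℝ≥0∞,
      ∑ ω ∈ s, ENNReal.ofReal (π ω) * g ω = ∑ ω, ENNReal.ofReal (π ω) * g ω := by
    intro g
    refine Finset.sum_subset (Finset.filter_subset _ _) fun ω _ hω => ?_
    have : π ω ≤ 0 := by simpa [hs] using hω
    rw [ENNReal.ofReal_of_nonpos this, zero_mul]
  have hne : s.Nonempty := by
    by_contra h
    rw [Finset.not_nonempty_iff_eq_empty] at h
    have := hrestrict fun _ => 1
    simp [h, hsum] at this
  refine (hK π hπ).not_gt ?_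
  calc K = ∑ ω, ENNReal.ofReal (π ω) * K := by rw [← Finset.sum_mul, hsum, one_mul]
    _ = ∑ ω ∈ s, ENNReal.ofReal (π ω) * K := (hrestrict fun _ => K).symm
    _ < ∑ ω ∈ s, ENNReal.ofReal (π ω) * f π ω := by
        refine ENNReal.sum_lt_sum_of_nonempty hne fun ω hω => ?_
        have hω' : 0 < π ω := (Finset.mem_filter.1 hω).2
        exact ENNReal.mul_lt_mul_right (ENNReal.ofReal_pos.2 hω').ne' ENNReal.ofReal_ne_top
          (hlt ω hω')
    _ = expect π (f π) := hrestrict _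

theorem pexp_ne_zero (r : ℝ) (t : ℝ≥0∞) : pexp r t ≠ 0 := by
  unfold pexp
  split_ifs
  · exact ENNReal.top_ne_zero
  · exact (ENNReal.ofReal_pos.2 (Real.exp_pos _)).ne'

theorem nexp_ne_zero (r : ℝ) {t : ℝ≥0∞} (ht : t ≠ ∞) : nexp r t ≠ 0 := by
  rw [nexp, if_neg ht]
  exact (ENNReal.ofReal_pos.2 (Real.exp_pos _)).ne'

/-- The bound on the cumulative loss obtained by taking logarithms. -/
theorem sum_le_of_mul_prod_le_one {p c η : ℝ} (hp : 0 < p) (hp₁ : p ≤ 1) (hc : 0 < c) (hη : 0 < η)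
    {ι : Type*} {s : Finset ι} {a b : ι → ℝ≥0∞}
    (h : ENNReal.ofReal p * ∏ k ∈ s, (pexp (η / c) (a k) * nexp η (b k)) ≤ 1) :
    ∑ k ∈ s, a k ≤
      ENNReal.ofReal c * ∑ k ∈ s, b k + ENNReal.ofReal (c / η * Real.log (1 / p)) := by
  have hp' : ENNReal.ofReal p ≠ 0 := (ENNReal.ofReal_pos.2 hp).ne'
  by_cases hb : ∀ k ∈ s, b k ≠ ∞
  swap
  · push Not at hb
    have : ∑ k ∈ s, b k = ∞ := ENNReal.sum_eq_top.2 hb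
    rw [this, ENNReal.mul_top (ENNReal.ofReal_pos.2 hc).ne', top_add]
    exact le_top
  have ha : ∀ k ∈ s, a k ≠ ∞ := by
    classical
    intro k hk hak
    have hprod : ∏ k ∈ s, (pexp (η / c) (a k) * nexp η (b k)) = ∞ := by
      rw [← Finset.mul_prod_erase _ _ hk, hak, pexp, if_pos rfl,
        ENNReal.top_mul (nexp_ne_zero η (hb k hk)), ENNReal.top_mul]
      exact Finset.prod_ne_zero_iff.2 fun j hj =>
        mul_ne_zero (pexp_ne_zero _ _) (nexp_ne_zero η (hb j (Finset.mem_of_mem_erase hj)))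
    rw [hprod, ENNReal.mul_top hp'] at h
    exact absurd h (by simp)
  have hprod : ∏ k ∈ s, (pexp (η / c) (a k) * nexp η (b k)) =
      ENNReal.ofReal (Real.exp (∑ k ∈ s, (η / c * (a k).toReal - η * (b k).toReal))) := by
    rw [Real.exp_sum, ENNReal.ofReal_prod_of_nonneg fun _ _ => (Real.exp_pos _).le]
    refine Finset.prod_congr rfl fun k hk => ?_
    rw [pexp, nexp, if_neg (ha k hk), if_neg (hb k hk), ← ENNReal.ofReal_mul (Real.exp_pos _).le,
      ← Real.exp_add, sub_eq_add_neg]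
  rw [hprod, ← ENNReal.ofReal_mul hp.le, ENNReal.ofReal_le_one] at h
  have hlog : ∑ k ∈ s, (η / c * (a k).toReal - η * (b k).toReal) ≤ Real.log (1 / p) := by
    rw [Real.le_log_iff_exp_le (by positivity), le_div_iff₀ hp, mul_comm]
    exact h
  rw [Finset.sum_sub_distrib, ← Finset.mul_sum, ← Finset.mul_sum] at hlog
  have hlog0 : 0 ≤ Real.log (1 / p) := Real.log_nonneg (by rw [le_div_iff₀ hp]; linarith)
  rw [← ENNReal.ofReal_toReal (ENNReal.sum_ne_top.2 ha),
    ← ENNReal.ofReal_toReal (ENNReal.sum_ne_top.2 hb), ENNReal.toReal_sum ha, ENNReal.toReal_sum hb,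
    ← ENNReal.ofReal_mul hc.le, ← ENNReal.ofReal_add (by positivity) (by positivity)]
  refine ENNReal.ofReal_le_ofReal ?_
  have h2 := mul_le_mul_of_nonneg_left hlog (by positivity : 0 ≤ c / η)
  have h3 : c / η * (η / c * ∑ k ∈ s, (a k).toReal - η * ∑ k ∈ s, (b k).toReal) =
      ∑ k ∈ s, (a k).toReal - c * ∑ k ∈ s, (b k).toReal := by
    field_simp
  linarith

/-- Theorem 9 of the paper: the Defensive Forecasting Algorithm for prediction
with expert evaluators' advice (each expert `θ` has its own loss function
`λ^θ` and constants `c^θ`, `η^θ`). -/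
theorem dfa_multi_loss
    {Ω : Type*} [Fintype Ω] [Nonempty Ω]
    {Θ : Type*} [Countable Θ] [Nonempty Θ]
    (P₀ : Θ → ℝ) (hP₀pos : ∀ θ, 0 < P₀ θ) (hP₀le : ∀ θ, P₀ θ ≤ 1)
    (hP₀sum : ∑' θ, ENNReal.ofReal (P₀ θ) = 1)
    (lam : Θ → (Ω → ℝ) → Ω → ℝ≥0∞)
    (cs ηs : Θ → ℝ) (hc : ∀ θ, 1 ≤ cs θ) (hη : ∀ θ, 0 < ηs θ)
    (hqcont : ∀ θ : Θ, ∀ g ∈ superpred (lam θ '' stdSimplex ℝ Ω), ∀ ω : Ω,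
      ContinuousOn (fun π => pexp (ηs θ / cs θ) (lam θ π ω) * nexp (ηs θ) (g ω))
        (stdSimplex ℝ Ω))
    (hqsuper : ∀ θ : Θ, ∀ g ∈ superpred (lam θ '' stdSimplex ℝ Ω),
      ∀ π ∈ stdSimplex ℝ Ω,
      expect π (fun ω => pexp (ηs θ / cs θ) (lam θ π ω) * nexp (ηs θ) (g ω)) ≤ 1)
    (πE : ℕ → Θ → Ω → ℝ) (hπE : ∀ n θ, πE n θ ∈ stdSimplex ℝ Ω)
    (πs : ℕ → Ω → ℝ) (hπs : ∀ n, πs n ∈ stdSimplex ℝ Ω)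
    (ωs : ℕ → Ω)
    (W : ℕ → ℝ≥0∞)
    (hW : ∀ n, W n = ∑' θ, ENNReal.ofReal (P₀ θ) *
      ∏ k ∈ Finset.range n,
        (pexp (ηs θ / cs θ) (lam θ (πs k) (ωs k)) *
          nexp (ηs θ) (lam θ (πE k θ) (ωs k)))) :
    -- (i) a suitable next decision always exists
    (∀ n : ℕ, ∃ πn ∈ stdSimplex ℝ Ω, ∀ ω : Ω,
      (∑' θ, ENNReal.ofReal (P₀ θ) *
        (∏ k ∈ Finset.range n,
          (pexp (ηs θ / cs θ) (lam θ (πs k) (ωs k)) *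
            nexp (ηs θ) (lam θ (πE k θ) (ωs k)))) *
        (pexp (ηs θ / cs θ) (lam θ πn ω) * nexp (ηs θ) (lam θ (πE n θ) ω))) ≤ W n) ∧
    -- (ii) the loss bound, for each expert with respect to its own loss
    (∀ N : ℕ, 1 ≤ N → (∀ n < N, W (n + 1) ≤ W n) → ∀ θ : Θ,
      ∑ n ∈ Finset.range N, lam θ (πs n) (ωs n) ≤
        ENNReal.ofReal (cs θ) * ∑ n ∈ Finset.range N, lam θ (πE n θ) (ωs n) +
          ENNReal.ofReal ((cs θ / ηs θ) * Real.log (1 / P₀ θ))) := by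
  refine ⟨fun n => ?_, fun N _ hmono θ => ?_⟩
  · set w : Θ → ℝ≥0∞ := fun θ => ENNReal.ofReal (P₀ θ) *
        ∏ k ∈ Finset.range n,
          (pexp (ηs θ / cs θ) (lam θ (πs k) (ωs k)) *
            nexp (ηs θ) (lam θ (πE k θ) (ωs k))) with hw
    have hWn : W n = ∑' θ, w θ := hW n
    rcases eq_or_ne (W n) ∞ with htop | htop
    · exact ⟨πs n, hπs n, fun ω => by rw [htop]; exact le_top⟩
    have hwtop : ∀ θ, w θ ≠ ∞ := fun θ => ENNReal.ne_top_of_tsum_ne_top (hWn ▸ htop) θ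
    have hg : ∀ θ, lam θ (πE n θ) ∈ superpred (lam θ '' stdSimplex ℝ Ω) := fun θ =>
      ⟨_, ⟨_, hπE n θ, rfl⟩, fun _ => le_rfl⟩
    refine exists_forall_le_of_expect_le (f := fun π ω => ∑' θ, w θ *
      (pexp (ηs θ / cs θ) (lam θ π ω) * nexp (ηs θ) (lam θ (πE n θ) ω))) (fun ω => ?_)
      fun π hπ => ?_
    · refine lowerSemicontinuousOn_tsum fun θ => ?_
      exact ((ENNReal.continuous_const_mul (hwtop θ)).comp_continuousOn
        (hqcont θ _ (hg θ) ω)).lowerSemicontinuousOn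
    · calc expect π (fun ω => ∑' θ, w θ *
            (pexp (ηs θ / cs θ) (lam θ π ω) * nexp (ηs θ) (lam θ (πE n θ) ω)))
          = ∑' θ, w θ * expect π (fun ω =>
            pexp (ηs θ / cs θ) (lam θ π ω) * nexp (ηs θ) (lam θ (πE n θ) ω)) := by
            simp only [expect, ← ENNReal.tsum_mul_left, Finset.mul_sum]
            rw [← Summable.tsum_finsetSum fun _ _ => ENNReal.summable]
            exact tsum_congr fun θ => Finset.sum_congr rfl fun ω _ => mul_left_comm _ _ _
        _ ≤ ∑' θ, w θ := ENNReal.tsum_le_tsum fun θ =>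
            mul_le_of_le_one_right zero_le (hqsuper θ _ (hg θ) π hπ)
        _ = W n := hWn.symm
  · have hle : ∀ n ≤ N, W n ≤ 1 := by
      intro n
      induction n with
      | zero => intro _; rw [hW]; simp [hP₀sum]
      | succ n ih => exact fun hn => (hmono n hn).trans (ih (Nat.le_of_succ_le hn))
    refine sum_le_of_mul_prod_le_one (hP₀pos θ) (hP₀le θ) (by linarith [hc θ]) (hη θ) ?_
    refine le_trans ?_ (hle N le_rfl)
    rw [hW]
    exact ENNReal.le_tsum (f := fun θ => ENNReal.ofReal (P₀ θ) *
      ∏ k ∈ Finset.range N, (pexp (ηs θ / cs θ) (lam θ (πs k) (ωs k)) *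
        nexp (ηs θ) (lam θ (πE k θ) (ωs k)))) θ
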